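/- arXiv:2412.07614 — 7 statements merged into one kernel-verified Lean document; each statement's English description precedes it below -/
import Mathlib

section
/- Let (K,d) be a compact metric space with more than one point and diameter D. Let g be a Möbius homeomorphism of K with metric derivative g'. Suppose η and ζ are two distinct points of K and 0 < c ≤ C are constants with c ≤ g'(η) ≤ C and c ≤ g'(ζ) ≤ C. Then for every θ ∈ K one has c²·d(η,ζ)/(2·C·D) ≤ g'(θ) ≤ 2·D/(c·d(η,ζ)). (This is the derivative-propagation estimate underlying Lemma 3.3 of the paper: a two-sided bound on the metric derivative at two separated points forces a two-sided bound everywhere.) -/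
/-- Derivative-propagation estimate for Möbius homeomorphisms of a
compact metric space: a two-sided bound on the metric derivative at two separated
points forces a two-sided bound everywhere. -/
theorem mobius_derivative_propagation {K : Type*} [MetricSpace K] [CompactSpace K]
    [Nontrivial K]
    (g : K ≃ₜ K) (g' : K → ℝ) (hg'cont : Continuous g') (hg'pos : ∀ x, 0 < g' x)
    (hmob : ∀ x y, dist (g x) (g y) = g' x * g' y * dist x y)
    (η ζ : K) (hηζ : η ≠ ζ) (c C : ℝ) (hc : 0 < c) (hcC : c ≤ C)
    (hηl : c ≤ g' η) (hηu : g' η ≤ C) (hζl : c ≤ g' ζ) (hζu : g' ζ ≤ C) :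
    ∀ θ : K,
      c ^ 2 * dist η ζ / (2 * C * Metric.diam (Set.univ : Set K)) ≤ g' θ ∧
      g' θ ≤ 2 * Metric.diam (Set.univ : Set K) / (c * dist η ζ) := by
  intro θ
  have hdist (x y : K) : dist x y ≤ Metric.diam (Set.univ : Set K) :=
    Metric.dist_le_diam_of_mem isCompact_univ.isBounded (Set.mem_univ x) (Set.mem_univ y)
  have hd : 0 < dist η ζ := dist_pos.2 hηζ
  have hD : 0 < Metric.diam (Set.univ : Set K) := hd.trans_le (hdist η ζ)
  have hC : 0 < C := hc.trans_le hcC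
  have hθ : 0 < g' θ := hg'pos θ
  constructor
  · have upper (x : K) (hx : g' x ≤ C) :
        dist (g θ) (g x) ≤ g' θ * C * Metric.diam (Set.univ : Set K) := by
      rw [hmob]
      gcongr
      exact hdist θ x
    have lower : c ^ 2 * dist η ζ ≤ dist (g η) (g ζ) := by
      rw [hmob, sq]
      gcongr
      exact (hg'pos η).le
    rw [div_le_iff₀ (by positivity)]
    linarith [upper η hηu, upper ζ hζu, dist_triangle_left (g η) (g ζ) (g θ)]
  · have upper (x : K) (hx : c ≤ g' x) :
        g' θ * c * dist θ x ≤ Metric.diam (Set.univ : Set K) := by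
      refine le_trans ?_ (hdist (g θ) (g x))
      rw [hmob]
      gcongr
    have triangle := mul_le_mul_of_nonneg_left (dist_triangle_left η ζ θ)
      (mul_pos hθ hc).le
    rw [le_div_iff₀ (by positivity)]
    linarith [upper η hηl, upper ζ hζl]
end

section
/- Let (K,d) be a compact metric space with diameter D > 0, and let g be a Möbius homeomorphism of K with metric derivative g'. Suppose g fixes three distinct points a, b, c ∈ K. Then g'(a) = g'(b) = g'(c) = 1, and moreover for every θ ∈ K one has d(a,b)/(2·D) ≤ g'(θ) ≤ 2·D/d(a,b). (This is the key estimate in Case 1 of the proof that Γ satisfies the (CAF) condition, Lemma 4.4: a Möbius map with three fixed points has metric derivative uniformly bounded above and below.) -/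
/-- A Möbius homeomorphism of a compact metric space fixing three
distinct points has metric derivative equal to `1` at those points, and metric
derivative uniformly bounded above and below everywhere. -/
theorem mobius_three_fixed_points {K : Type*} [MetricSpace K] [CompactSpace K]
    (hD : 0 < Metric.diam (Set.univ : Set K))
    (g : K ≃ₜ K) (g' : K → ℝ) (hg'cont : Continuous g') (hg'pos : ∀ x, 0 < g' x)
    (hmob : ∀ x y, dist (g x) (g y) = g' x * g' y * dist x y)
    (a b c : K) (hab : a ≠ b) (hac : a ≠ c) (hbc : b ≠ c)
    (hga : g a = a) (hgb : g b = b) (hgc : g c = c) :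
    g' a = 1 ∧ g' b = 1 ∧ g' c = 1 ∧
      ∀ θ : K,
        dist a b / (2 * Metric.diam (Set.univ : Set K)) ≤ g' θ ∧
        g' θ ≤ 2 * Metric.diam (Set.univ : Set K) / dist a b := by
  have hmul {x y : K} (hxy : x ≠ y) (hx : g x = x) (hy : g y = y) : g' x * g' y = 1 := by
    have h := hmob x y
    rw [hx, hy] at h
    exact (mul_eq_right₀ (dist_pos.2 hxy).ne').1 h.symm
  have h₁ := hmul hab hga hgb
  have h₂ := hmul hac hga hgc
  have h₃ := hmul hbc hgb hgc
  have hbc' : g' b = g' c := mul_left_cancel₀ (hg'pos a).ne' (h₁.trans h₂.symm)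
  have hb : g' b = 1 := by
    rw [← hbc'] at h₃
    nlinarith [hg'pos b]
  have ha : g' a = 1 := by simpa [hb] using h₁
  refine ⟨ha, hb, hbc' ▸ hb, fun θ => ?_⟩
  have hle (x y : K) : dist x y ≤ Metric.diam (Set.univ : Set K) :=
    Metric.dist_le_diam_of_mem isCompact_univ.isBounded (Set.mem_univ x) (Set.mem_univ y)
  have hθa : dist (g θ) a = g' θ * dist θ a := by simpa [hga, ha] using hmob θ a
  have hθb : dist (g θ) b = g' θ * dist θ b := by simpa [hgb, hb] using hmob θ b
  have hθ := hg'pos θ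
  constructor
  · rw [div_le_iff₀ (by positivity)]
    calc dist a b ≤ dist (g θ) a + dist (g θ) b := dist_triangle_left a b (g θ)
      _ = g' θ * (dist θ a + dist θ b) := by rw [hθa, hθb, mul_add]
      _ ≤ g' θ * (2 * Metric.diam (Set.univ : Set K)) := by
        gcongr
        linarith [hle θ a, hle θ b]
  · rw [le_div_iff₀ (dist_pos.2 hab)]
    calc g' θ * dist a b ≤ g' θ * (dist θ a + dist θ b) := by
          gcongr
          exact dist_triangle_left a b θ
      _ = dist (g θ) a + dist (g θ) b := by rw [hθa, hθb, mul_add]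
      _ ≤ 2 * Metric.diam (Set.univ : Set K) := by linarith [hle (g θ) a, hle (g θ) b]
end

section
/- Let (K,d) be a compact metric space with at least three points, let ξ ≠ η be two points of K, and let κ > 0 and M ≥ 1. Let A be the set of all Möbius homeomorphisms g of K (with metric derivative g') such that d(gξ, gη) ≥ κ and M⁻¹ ≤ g'(ξ) ≤ M. Then A is precompact: every sequence of elements of A admits a subsequence that converges uniformly on K to a Möbius homeomorphism of K. (Lemma 3.4 of the paper, the precompactness criterion.) -/
open Filter Topology

/-- A metric derivative of a Möbius map is bounded below and above in terms of bounds for its values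
at two points whose images are separated. -/
theorem mobius_derivative_bounds {K : Type*} [MetricSpace K] {ξ η : K} (hξη : ξ ≠ η)
    {κ M D : ℝ} (hκ : 0 < κ) (hM : 1 ≤ M) (hD : ∀ x y : K, dist x y ≤ D)
    {f : K → K} {f' : K → ℝ} (hpos : ∀ x, 0 < f' x)
    (hmob : ∀ x y, dist (f x) (f y) = f' x * f' y * dist x y)
    (hsep : κ ≤ dist (f ξ) (f η)) (hder : M⁻¹ ≤ f' ξ ∧ f' ξ ≤ M) (x : K) :
    κ / (2 * D * (D * M / dist ξ η + M)) ≤ f' x ∧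
      f' x ≤ 2 * D * (M + D * M / κ) / dist ξ η := by
  have hd : 0 < dist ξ η := dist_pos.2 hξη
  have hD0 : 0 < D := hd.trans_le (hD _ _)
  have hM0 : 0 < M := by linarith
  have hx := hpos x
  have hlowξ : 1 ≤ M * f' ξ := by
    have := mul_le_mul_of_nonneg_left hder.1 hM0.le
    rwa [mul_inv_cancel₀ hM0.ne'] at this
  have hξη_eq := hmob ξ η
  have hupη : f' η ≤ D * M / dist ξ η := by
    rw [le_div_iff₀ hd]
    calc f' η * dist ξ η ≤ (M * f' ξ) * (f' η * dist ξ η) :=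
          le_mul_of_one_le_left (mul_nonneg (hpos η).le hd.le) hlowξ
      _ = dist (f ξ) (f η) * M := by rw [hξη_eq]; ring
      _ ≤ D * M := by gcongr; exact hD _ _
  have hlowη : κ ≤ D * M * f' η := by
    calc κ ≤ f' ξ * f' η * dist ξ η := hξη_eq ▸ hsep
      _ ≤ M * f' η * D := by
        gcongr
        · exact mul_nonneg hM0.le (hpos η).le
        · exact (hpos η).le
        · exact hder.2
        · exact hD _ _
      _ = D * M * f' η := by ring
  have hξ_le : f' x * dist x ξ ≤ D * M := by
    calc f' x * dist x ξ ≤ (M * f' ξ) * (f' x * dist x ξ) :=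
          le_mul_of_one_le_left (mul_nonneg hx.le dist_nonneg) hlowξ
      _ = dist (f x) (f ξ) * M := by rw [hmob x ξ]; ring
      _ ≤ D * M := by gcongr; exact hD _ _
  have hη_le : f' x * dist x η ≤ D * (D * M / κ) := by
    have : 1 ≤ D * M / κ * f' η := by
      rw [div_mul_eq_mul_div, le_div_iff₀ hκ]; simpa using hlowη
    calc f' x * dist x η ≤ (D * M / κ * f' η) * (f' x * dist x η) :=
          le_mul_of_one_le_left (mul_nonneg hx.le dist_nonneg) this
      _ = dist (f x) (f η) * (D * M / κ) := by rw [hmob x η]; ring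
      _ ≤ D * (D * M / κ) := by gcongr; exact hD _ _
  have hB : 0 < D * M / dist ξ η := by positivity
  constructor
  · rw [div_le_iff₀ (by positivity)]
    have hxξ : dist (f x) (f ξ) ≤ f' x * M * D := by
      rw [hmob x ξ]
      gcongr
      exacts [hder.2, hD _ _]
    have hxη : dist (f x) (f η) ≤ f' x * (D * M / dist ξ η) * D := by
      rw [hmob x η]
      gcongr
      exact hD _ _
    have hpos_sum : 0 ≤ f' x * D * (D * M / dist ξ η + M) := by positivity
    have := dist_triangle_left (f ξ) (f η) (f x)
    linarith
  · rw [le_div_iff₀ hd]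
    have htri := mul_le_mul_of_nonneg_left (dist_triangle_left ξ η x) hx.le
    have h1 : 0 ≤ D * M := by positivity
    have h2 : 0 ≤ D * (D * M / κ) := by positivity
    linarith

/-- A positive metric derivative of a continuous map on a space with at least two points is
continuous. -/
theorem continuous_mobius_derivative {K : Type*} [MetricSpace K] [Nontrivial K] {f : K → K}
    {f' : K → ℝ} (hf : Continuous f) (hpos : ∀ x, 0 < f' x)
    (hmob : ∀ x y, dist (f x) (f y) = f' x * f' y * dist x y) : Continuous f' := by
  refine continuous_iff_continuousAt.2 fun x => ?_
  obtain ⟨y, hyx⟩ := exists_ne x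
  have hcont : ContinuousAt (fun t => dist (f t) (f y) / (f' y * dist t y)) x := by
    refine ContinuousAt.div (by fun_prop) (by fun_prop) ?_
    exact mul_ne_zero (hpos y).ne' (dist_ne_zero.2 hyx.symm)
  refine hcont.congr ?_
  filter_upwards [isOpen_ne.mem_nhds hyx.symm] with t ht
  have := (hpos y).ne'
  have := dist_ne_zero.2 ht
  rw [hmob t y]
  field_simp

/-- A uniform limit of surjective self-maps of a compact space is surjective if it is continuous. -/
theorem TendstoUniformly.surjective_of_compactSpace {K ι : Type*} [MetricSpace K] [CompactSpace K]
    {l : Filter ι} [l.NeBot] {F : ι → K → K} {f : K → K} (h : TendstoUniformly F f l)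
    (hF : ∀ i, Function.Surjective (F i)) (hf : Continuous f) : Function.Surjective f := by
  intro y
  have hclosed : IsClosed (Set.range f) := (isCompact_range hf).isClosed
  change y ∈ Set.range f
  rw [← hclosed.closure_eq, Metric.mem_closure_iff]
  intro ε hε
  obtain ⟨i, hi⟩ := (Metric.tendstoUniformly_iff.1 h ε hε).exists
  obtain ⟨x, rfl⟩ := hF i y
  exact ⟨f x, ⟨x, rfl⟩, by rw [dist_comm]; exact hi x⟩

/-- A sequence of uniformly Lipschitz self-maps of a compact metric space has a uniformly
convergent subsequence. -/
theorem exists_subseq_tendstoUniformly_of_lipschitz {K : Type*} [MetricSpace K] [CompactSpace K]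
    {f : ℕ → K → K} {L : NNReal} (hf : ∀ n, LipschitzWith L (f n)) :
    ∃ φ : ℕ → ℕ, StrictMono φ ∧ ∃ h : K → K, Continuous h ∧
      TendstoUniformly (fun n => f (φ n)) h atTop := by
  let F : ℕ → BoundedContinuousFunction K K := fun n =>
    BoundedContinuousFunction.mkOfCompact ⟨f n, (hf n).continuous⟩
  have hcomp : IsCompact (closure (Set.range F)) := by
    refine BoundedContinuousFunction.arzela_ascoli Set.univ isCompact_univ _
      (fun _ _ _ => Set.mem_univ _) (UniformEquicontinuous.equicontinuous ?_)
    refine LipschitzWith.uniformEquicontinuous _ L ?_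
    rintro ⟨_, n, rfl⟩
    exact hf n
  obtain ⟨h, -, φ, hφ, hlim⟩ := hcomp.tendsto_subseq fun n => subset_closure ⟨n, rfl⟩
  exact ⟨φ, hφ, h, h.continuous, BoundedContinuousFunction.tendsto_iff_tendstoUniformly.1 hlim⟩

/-- precompactness criterion, Lemma 3.4. Every sequence of Möbius
homeomorphisms of a compact metric space with at least three points whose images of a
fixed pair of distinct points stay `κ`-separated, and whose metric derivative at `ξ` is
pinched between `M⁻¹` and `M`, admits a subsequence converging uniformly to a Möbius
homeomorphism. -/
theorem mobius_precompact {K : Type*} [MetricSpace K] [CompactSpace K]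
    (h3 : ∃ a b c : K, a ≠ b ∧ a ≠ c ∧ b ≠ c)
    (ξ η : K) (hξη : ξ ≠ η) (κ M : ℝ) (hκ : 0 < κ) (hM : 1 ≤ M)
    (g : ℕ → K ≃ₜ K) (g' : ℕ → K → ℝ)
    (hcont : ∀ n, Continuous (g' n)) (hpos : ∀ n x, 0 < g' n x)
    (hmob : ∀ n x y, dist (g n x) (g n y) = g' n x * g' n y * dist x y)
    (hsep : ∀ n, κ ≤ dist (g n ξ) (g n η))
    (hder : ∀ n, M⁻¹ ≤ g' n ξ ∧ g' n ξ ≤ M) :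
    ∃ φ : ℕ → ℕ, StrictMono φ ∧
      ∃ (h : K ≃ₜ K) (h' : K → ℝ),
        Continuous h' ∧ (∀ x, 0 < h' x) ∧
        (∀ x y, dist (h x) (h y) = h' x * h' y * dist x y) ∧
        TendstoUniformly (fun n x => g (φ n) x) (⇑h) Filter.atTop := by
  obtain ⟨D, hD⟩ : ∃ D, ∀ x y : K, dist x y ≤ D :=
    ⟨Metric.diam Set.univ, fun x y => Metric.dist_le_diam_of_mem
      isCompact_univ.isBounded (Set.mem_univ x) (Set.mem_univ y)⟩
  have : Nontrivial K := ⟨ξ, η, hξη⟩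
  have hd : 0 < dist ξ η := dist_pos.2 hξη
  have hD0 : 0 < D := hd.trans_le (hD _ _)
  have hM0 : 0 < M := by linarith
  obtain ⟨c, C, hc, hC, hbd⟩ : ∃ c C : ℝ, 0 < c ∧ 0 < C ∧ ∀ n x, g' n x ∈ Set.Icc c C :=
    ⟨_, _, by positivity, by positivity, fun n x =>
      mobius_derivative_bounds hξη hκ hM hD (hpos n) (hmob n) (hsep n) (hder n) x⟩
  have hlip : ∀ n, LipschitzWith (C * C).toNNReal (g n) := fun n =>
    LipschitzWith.of_dist_le' fun x y => by
      rw [hmob n x y]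
      gcongr
      exacts [(hpos n y).le, (hbd n x).2, (hbd n y).2]
  obtain ⟨φ, hφ, h, hh, hlim⟩ := exists_subseq_tendstoUniformly_of_lipschitz hlip
  have hder_lim : ∀ x, ∃ l ∈ Set.Icc c C,
      Tendsto (fun n => g' (φ n) x) (hyperfilter ℕ) (𝓝 l) := fun x =>
    isCompact_Icc.ultrafilter_le_nhds' ((hyperfilter ℕ).map fun n => g' (φ n) x)
      (Ultrafilter.mem_map.2 (univ_mem' fun n => hbd (φ n) x))
  choose h' hmem hh' using hder_lim
  have hpos' : ∀ x, 0 < h' x := fun x => hc.trans_le (hmem x).1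
  have hmob' : ∀ x y, dist (h x) (h y) = h' x * h' y * dist x y := fun x y => by
    have hg : Tendsto (fun n => dist (g (φ n) x) (g (φ n) y)) (hyperfilter ℕ)
        (𝓝 (dist (h x) (h y))) :=
      ((hlim.tendsto_at x).dist (hlim.tendsto_at y)).mono_left Nat.hyperfilter_le_atTop
    simp only [hmob] at hg
    exact tendsto_nhds_unique hg (((hh' x).mul (hh' y)).mul_const _)
  have hinj : Function.Injective h := fun x y hxy => by
    have := hmob' x y
    rw [hxy, dist_self, eq_comm] at this
    exact dist_eq_zero.1
      ((mul_eq_zero.1 this).resolve_left (mul_pos (hpos' x) (hpos' y)).ne')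
  have hsurj := hlim.surjective_of_compactSpace (fun n => (g (φ n)).surjective) hh
  exact ⟨φ, hφ, Continuous.homeoOfEquivCompactToT2 (f := Equiv.ofBijective h ⟨hinj, hsurj⟩) hh,
    h', continuous_mobius_derivative hh hpos' hmob', hpos', hmob', hlim⟩
end

section
/- Let (K,d) be a compact metric space with at least three points and let Γ be a group of Möbius homeomorphisms of K. Assume that for every M ≥ 1 the set { γ ∈ Γ : M⁻¹ ≤ γ'(x) ≤ M for all x ∈ K } is finite, where γ' denotes the metric derivative of γ. Then Γ is discrete in the uniform topology: there exists ε > 0 such that every γ ∈ Γ satisfying sup_{x ∈ K} d(γ x, x) < ε is the identity map. (This is the discreteness statement of Lemma 3.3 of the paper, phrased for groups of Möbius homeomorphisms.) -/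
/-- A map moving points by less than `ε` distorts the distance of points that are at least `4 * ε`
apart by a factor between `1 / 2` and `3 / 2`. -/
theorem conformal_factor_mem_Icc_of_dist_lt {X : Type*} [PseudoMetricSpace X] {f : X → X}
    {ε t : ℝ} {x y : X} (hε : 0 < ε) (hf : ∀ z, dist (f z) z < ε) (hxy : 4 * ε ≤ dist x y)
    (ht : dist (f x) (f y) = t * dist x y) : t ∈ Set.Icc (1 / 2 : ℝ) (3 / 2) := by
  have h₁ := dist_triangle4 (f x) x y (f y)
  have h₂ := dist_triangle4 x (f x) (f y) y
  rw [dist_comm y (f y)] at h₁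
  rw [dist_comm x (f x)] at h₂
  have hx := hf x
  have hy := hf y
  have hpos : 0 < dist x y := by linarith
  constructor
  · refine le_of_mul_le_mul_right ?_ hpos
    linarith
  · refine le_of_mul_le_mul_right ?_ hpos
    linarith

/-- Bounds on the pairwise products of three positive reals bound each of them. -/
theorem mem_Icc_of_pairwise_mul_mem_Icc {p q r : ℝ} (hp : 0 < p) (hq : 0 < q) (hr : 0 < r)
    (hpq : p * q ∈ Set.Icc (1 / 2 : ℝ) (3 / 2)) (hpr : p * r ∈ Set.Icc (1 / 2 : ℝ) (3 / 2))
    (hqr : q * r ∈ Set.Icc (1 / 2 : ℝ) (3 / 2)) : p ∈ Set.Icc (1 / 3 : ℝ) 3 := by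
  have heq : p ^ 2 * (q * r) = (p * q) * (p * r) := by ring
  have hlow : (1 / 2 : ℝ) * (1 / 2) ≤ (p * q) * (p * r) :=
    mul_le_mul hpq.1 hpr.1 (by norm_num) (by positivity)
  have hupp : (p * q) * (p * r) ≤ (3 / 2 : ℝ) * (3 / 2) :=
    mul_le_mul hpq.2 hpr.2 (by positivity) (by norm_num)
  have h₁ : p ^ 2 * (q * r) ≤ p ^ 2 * (3 / 2) := mul_le_mul_of_nonneg_left hqr.2 (by positivity)
  have h₂ : p ^ 2 * (1 / 2) ≤ p ^ 2 * (q * r) := mul_le_mul_of_nonneg_left hqr.1 (by positivity)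
  constructor <;> nlinarith

/-- A Möbius map moving points by less than `ε` has metric derivative between `1 / 6` and `6`, if
the space contains three points at mutual distance at least `8 * ε`. -/
theorem metric_derivative_bounds_of_dist_lt {X : Type*} [PseudoMetricSpace X] {f : X → X}
    {f' : X → ℝ} {ε : ℝ} {a b c : X} (hε : 0 < ε) (hab : 8 * ε ≤ dist a b)
    (hac : 8 * ε ≤ dist a c) (hbc : 8 * ε ≤ dist b c) (hpos : ∀ x, 0 < f' x)
    (hmob : ∀ x y, dist (f x) (f y) = f' x * f' y * dist x y)
    (hf : ∀ x, dist (f x) x < ε) (x : X) : (6 : ℝ)⁻¹ ≤ f' x ∧ f' x ≤ 6 := by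
  have key : ∀ y z, 4 * ε ≤ dist y z → f' y * f' z ∈ Set.Icc (1 / 2 : ℝ) (3 / 2) :=
    fun y z h => conformal_factor_mem_Icc_of_dist_lt hε hf h (hmob y z)
  have kab := key a b (by linarith)
  have kac := key a c (by linarith)
  have kbc := key b c (by linarith)
  have ha := mem_Icc_of_pairwise_mul_mem_Icc (hpos a) (hpos b) (hpos c) kab kac kbc
  have hb := mem_Icc_of_pairwise_mul_mem_Icc (hpos b) (hpos a) (hpos c)
    (mul_comm (f' a) (f' b) ▸ kab) kbc kac
  have bounds : ∀ y, f' y ∈ Set.Icc (1 / 3 : ℝ) 3 → 4 * ε ≤ dist x y →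
      (6 : ℝ)⁻¹ ≤ f' x ∧ f' x ≤ 6 := by
    intro y hy hxy
    have hk := key x y hxy
    have hx := hpos x
    have h₁ := mul_le_mul_of_nonneg_left hy.1 hx.le
    have h₂ := mul_le_mul_of_nonneg_left hy.2 hx.le
    have h₃ := hk.1
    have h₄ := hk.2
    constructor
    · rw [inv_eq_one_div]
      linarith
    · linarith
  rcases le_total (4 * ε) (dist x a) with h | h
  · exact bounds a ha h
  · refine bounds b hb ?_
    have := dist_triangle_left a b x
    linarith

/-- discreteness, Lemma 3.3. A group of Möbius homeomorphisms of a
compact metric space with at least three points, in which for every `M ≥ 1` only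
finitely many elements have metric derivative pinched between `M⁻¹` and `M`
everywhere, is discrete in the uniform topology. -/
theorem mobius_group_discrete {K : Type*} [MetricSpace K] [CompactSpace K]
    (h3 : ∃ a b c : K, a ≠ b ∧ a ≠ c ∧ b ≠ c)
    (Γ : Set (K ≃ₜ K)) (hΓone : Homeomorph.refl K ∈ Γ)
    (hΓmul : ∀ γ₁ ∈ Γ, ∀ γ₂ ∈ Γ, γ₁.trans γ₂ ∈ Γ) (hΓinv : ∀ γ ∈ Γ, γ.symm ∈ Γ)
    (der : (K ≃ₜ K) → K → ℝ)
    (hcont : ∀ γ ∈ Γ, Continuous (der γ))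
    (hpos : ∀ γ ∈ Γ, ∀ x, 0 < der γ x)
    (hmob : ∀ γ ∈ Γ, ∀ x y, dist (γ x) (γ y) = der γ x * der γ y * dist x y)
    (hfin : ∀ M : ℝ, 1 ≤ M →
      {γ : K ≃ₜ K | γ ∈ Γ ∧ ∀ x, M⁻¹ ≤ der γ x ∧ der γ x ≤ M}.Finite) :
    ∃ ε > 0, ∀ γ ∈ Γ, (∀ x, dist (γ x) x < ε) → γ = Homeomorph.refl K := by
  obtain ⟨a, b, c, hab, hac, hbc⟩ := h3
  obtain ⟨δ, hδ, hδab, hδac, hδbc⟩ : ∃ δ > 0, 8 * δ ≤ dist a b ∧ 8 * δ ≤ dist a c ∧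
      8 * δ ≤ dist b c := by
    have h₁ := dist_pos.2 hab
    have h₂ := dist_pos.2 hac
    have h₃ := dist_pos.2 hbc
    refine ⟨min (dist a b) (min (dist a c) (dist b c)) / 8, by positivity, ?_, ?_, ?_⟩ <;>
      rw [mul_div_cancel₀ _ (by norm_num)] <;> simp
  have hsep : ∀ᶠ ε in nhdsWithin (0 : ℝ) (Set.Ioi 0),
      ∀ γ ∈ {γ : K ≃ₜ K | γ ∈ Γ ∧ ∀ x, (6 : ℝ)⁻¹ ≤ der γ x ∧ der γ x ≤ 6},
        (∀ x, dist (γ x) x < ε) → γ = Homeomorph.refl K := by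
    refine (Filter.eventually_all_finite (hfin 6 (by norm_num))).2 fun γ _ => ?_
    by_cases hγ : γ = Homeomorph.refl K
    · exact Filter.Eventually.of_forall fun _ _ => hγ
    · obtain ⟨x, hx⟩ : ∃ x, γ x ≠ x := by
        by_contra! h
        exact hγ (Homeomorph.ext h)
      filter_upwards [Ioo_mem_nhdsGT (dist_pos.2 hx)] with ε hε hlt
      exact absurd (hlt x) hε.2.not_gt
  obtain ⟨ε, hsepε, hε, hεδ⟩ := (hsep.and (Ioo_mem_nhdsGT hδ)).exists
  refine ⟨ε, hε, fun γ hγ hlt => hsepε γ ⟨hγ, ?_⟩ hlt⟩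
  exact metric_derivative_bounds_of_dist_lt hδ hδab hδac hδbc (hpos γ hγ) (hmob γ hγ)
    fun x => (hlt x).trans hεδ
end

section
/- Let (K,d) be a compact metric space. Let (g_n) be a sequence of Möbius homeomorphisms of K with metric derivatives g_n'. Suppose g_n converges uniformly on K to a map g : K → K, and g_n' converges pointwise on K to a continuous function φ : K → (0,∞). Then g is a Möbius homeomorphism of K with metric derivative φ; in particular d(g x, g y) = φ(x)·φ(y)·d(x,y) for all x, y ∈ K. -/
/-- A uniform limit of surjections into a metric space has dense range. -/
theorem TendstoUniformly.denseRange_of_surjective {ι X Y : Type*} [PseudoMetricSpace Y]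
    {F : ι → X → Y} {f : X → Y} {p : Filter ι} [p.NeBot]
    (h : TendstoUniformly F f p) (hF : ∀ i, Function.Surjective (F i)) : DenseRange f := by
  refine fun y => Metric.mem_closure_iff.2 fun ε hε => ?_
  obtain ⟨i, hi⟩ := (Metric.tendstoUniformly_iff.1 h ε hε).exists
  obtain ⟨x, rfl⟩ := hF i y
  exact ⟨f x, Set.mem_range_self x, by simpa only [dist_comm] using hi x⟩

/-- A uniform limit of Möbius homeomorphisms of a compact metric
space whose metric derivatives converge pointwise to a continuous positive function
`φ` is a Möbius homeomorphism with metric derivative `φ`. -/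
theorem mobius_limit {K : Type*} [MetricSpace K] [CompactSpace K]
    (g : ℕ → K ≃ₜ K) (g' : ℕ → K → ℝ)
    (hcont : ∀ n, Continuous (g' n)) (hpos : ∀ n x, 0 < g' n x)
    (hmob : ∀ n x y, dist (g n x) (g n y) = g' n x * g' n y * dist x y)
    (f : K → K) (hunif : TendstoUniformly (fun n x => g n x) f Filter.atTop)
    (φ : K → ℝ) (hφcont : Continuous φ) (hφpos : ∀ x, 0 < φ x)
    (hptw : ∀ x, Filter.Tendsto (fun n => g' n x) Filter.atTop (nhds (φ x))) :
    ∃ G : K ≃ₜ K, ⇑G = f ∧ ∀ x y, dist (f x) (f y) = φ x * φ y * dist x y := by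
  have hdist : ∀ x y, dist (f x) (f y) = φ x * φ y * dist x y := fun x y =>
    tendsto_nhds_unique ((hunif.tendsto_at x).dist (hunif.tendsto_at y))
      (by simpa only [hmob] using ((hptw x).mul (hptw y)).mul_const (dist x y))
  have hf : Continuous f := hunif.continuous (Filter.Frequently.of_forall fun n => (g n).continuous)
  have hinj : Function.Injective f := fun x y hxy => by
    have h := hdist x y
    rw [hxy, dist_self, eq_comm, mul_eq_zero] at h
    exact dist_eq_zero.1 (h.resolve_left (mul_pos (hφpos x) (hφpos y)).ne')
  have hsurj : Function.Surjective f := by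
    rw [← Set.range_eq_univ, ← (isCompact_range hf).isClosed.closure_eq]
    exact (hunif.denseRange_of_surjective fun n => (g n).surjective).closure_eq
  exact ⟨Continuous.homeoOfEquivCompactToT2 (f := Equiv.ofBijective f ⟨hinj, hsurj⟩) hf,
    rfl, hdist⟩
end

section
/- Let (X, d_X) be a metric space with a basepoint p, let (Λ, ρ) be a compact metric space, and let ε > 0 and δ ≥ 0. Let b : Λ × X → ℝ be a function such that: (i) for each x ∈ X the map ξ ↦ b(ξ,x) is Borel measurable; (ii) 0 ≤ b(ξ,x) ≤ d_X(x,p) for all ξ ∈ Λ and x ∈ X; (iii) ρ(ξ,ζ) ≤ exp(ε·δ − ε·min(b(ξ,x), b(ζ,x))) for all ξ, ζ ∈ Λ and x ∈ X. Let v be an atomless Borel probability measure on Λ. Then there exists K > 0 such that for every x ∈ X with d_X(x,p) ≥ K one has ∫_Λ (d_X(x,p) − 2·b(ξ,x)) dv(ξ) ≥ d_X(x,p)/12. In particular, the function x ↦ ∫_Λ (d_X(x,p) − 2·b(ξ,x)) dv(ξ) tends to infinity as d_X(x,p) → ∞, so for every L > 0 its sublevel set at level inf + L is bounded. (This is Lemma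 4.3 of the paper on barycenters, with b(ξ,x) playing the role of the Gromov product (ξ,x)_p of a point of X with a boundary point in the limit set: in a δ-hyperbolic space with visual metric ρ = exp(−ε(·,·)_p), conditions (ii) and (iii) hold.) -/
open MeasureTheory

/-- On a compact metric space, an atomless finite measure gives uniformly small mass to
balls of a sufficiently small radius. -/
theorem exists_pos_forall_measure_ball_lt {Λ : Type*} [MetricSpace Λ] [CompactSpace Λ]
    [MeasurableSpace Λ] [BorelSpace Λ] (v : Measure Λ) [IsFiniteMeasure v]
    (hatomless : ∀ ξ : Λ, v {ξ} = 0) {η : ENNReal} (hη : 0 < η) :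
    ∃ r : ℝ, 0 < r ∧ ∀ ξ : Λ, v (Metric.ball ξ r) < η := by
  have hU : ∀ ξ : Λ, ∃ U : Set Λ, {ξ} ⊆ U ∧ IsOpen U ∧ v U < η := fun ξ =>
    Set.exists_isOpen_lt_of_lt {ξ} η (by rwa [hatomless ξ])
  choose U hmem hopen hlt using hU
  obtain ⟨r, hr, hball⟩ := lebesgue_number_lemma_of_metric (isCompact_univ (X := Λ)) hopen
    (fun ξ _ => Set.mem_iUnion.2 ⟨ξ, hmem ξ rfl⟩)
  refine ⟨r, hr, fun ξ => ?_⟩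
  obtain ⟨i, hi⟩ := hball ξ (Set.mem_univ ξ)
  exact (measure_mono hi).trans_lt (hlt i)

/-- Lemma 4.3, barycenters. If `b : Λ × X → ℝ` plays the role of the
Gromov product with basepoint `p` (Borel in the first variable, squeezed between `0`
and `dist x p`, and controlling the visual metric `ρ(ξ,ζ) ≤ exp(εδ − ε·min(b ξ x, b ζ x))`),
and `v` is an atomless Borel probability measure on the compact space `Λ`, then the
"barycenter functional" `x ↦ ∫ (dist x p − 2 b ξ x) dv(ξ)` is at least `dist x p / 12`
whenever `dist x p` is large enough. -/
theorem barycenter_functional_proper {X Λ : Type*} [MetricSpace X] [MetricSpace Λ]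
    [CompactSpace Λ] [MeasurableSpace Λ] [BorelSpace Λ]
    (p : X) (ε δ : ℝ) (hε : 0 < ε) (hδ : 0 ≤ δ)
    (b : Λ → X → ℝ)
    (hmeas : ∀ x : X, Measurable fun ξ : Λ => b ξ x)
    (hb0 : ∀ (ξ : Λ) (x : X), 0 ≤ b ξ x)
    (hb1 : ∀ (ξ : Λ) (x : X), b ξ x ≤ dist x p)
    (hvis : ∀ (ξ ζ : Λ) (x : X),
      dist ξ ζ ≤ Real.exp (ε * δ - ε * min (b ξ x) (b ζ x)))
    (v : Measure Λ) [IsProbabilityMeasure v] (hatomless : ∀ ξ : Λ, v {ξ} = 0) :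
    ∃ K : ℝ, 0 < K ∧ ∀ x : X, K ≤ dist x p →
      dist x p / 12 ≤ ∫ ξ, (dist x p - 2 * b ξ x) ∂v := by
  obtain ⟨r, hr, hball⟩ := exists_pos_forall_measure_ball_lt v hatomless
    (η := ENNReal.ofReal (1 / 8)) (by simp)
  refine ⟨max 1 (4 * (δ - Real.log r / ε) + 1), by positivity, fun x hx => ?_⟩
  obtain ⟨hx1, hxr⟩ := max_le_iff.1 hx
  set D := dist x p
  have hexp : Real.exp (ε * δ - ε * (D / 4)) < r := by
    rw [← Real.lt_log_iff_exp_lt hr]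
    have hlog : ε * (Real.log r / ε) = Real.log r := mul_div_cancel₀ _ hε.ne'
    nlinarith
  let A : Set Λ := {ξ | D / 4 < b ξ x}
  have hA : MeasurableSet A := measurableSet_lt measurable_const (hmeas x)
  have hvA : v.real A ≤ 1 / 8 := by
    refine ENNReal.toReal_le_of_le_ofReal (by norm_num) ?_
    rcases A.eq_empty_or_nonempty with hempty | ⟨ξ, hξ⟩
    · simp [hempty]
    · refine (measure_mono fun ζ hζ => ?_).trans (hball ξ).le
      refine Metric.mem_ball.2 ((hvis ζ ξ x).trans_lt (hexp.trans_le' ?_))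
      have hmin : D / 4 ≤ min (b ζ x) (b ξ x) := le_min (le_of_lt hζ) (le_of_lt hξ)
      gcongr
  have hb_int : Integrable (fun ξ => b ξ x) v :=
    Integrable.of_bound (hmeas x).aestronglyMeasurable D
      (ae_of_all _ fun ξ => by simpa [abs_of_nonneg (hb0 ξ x)] using hb1 ξ x)
  have hind_int : Integrable (A.indicator fun _ => D) v :=
    (integrable_const D).indicator hA
  have hb_le : ∫ ξ, b ξ x ∂v ≤ D / 4 + v.real A * D := by
    calc ∫ ξ, b ξ x ∂v ≤ ∫ ξ, (D / 4 + A.indicator (fun _ => D) ξ) ∂v := by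
          refine integral_mono hb_int ((integrable_const _).add hind_int) fun ξ => ?_
          by_cases hξ : ξ ∈ A
          · simp only [Set.indicator_of_mem hξ]
            linarith [hb1 ξ x]
          · simpa [Set.indicator_of_notMem hξ] using not_lt.1 hξ
      _ = D / 4 + v.real A * D := by
          rw [integral_add (integrable_const _) hind_int, integral_indicator_const _ hA]
          simp
  rw [integral_sub (integrable_const _) (hb_int.const_mul 2), integral_const_mul]
  simp only [integral_const, probReal_univ, one_smul]
  nlinarith
end

section
/- Let Γ be a group, N a finite normal subgroup of Γ, and Γ₁ a subgroup of Γ of finite index. Let s : Γ₁ → Γ be a group homomorphism such that s(γ) ∈ γN for every γ ∈ Γ₁ (equivalently, γ⁻¹·s(γ) ∈ N for all γ ∈ Γ₁). Then the subgroup { γ ∈ Γ₁ : s(γ) = γ } has finite index in Γ. (This is the group-theoretic core of Lemma 5.1 of the paper: an abstract commensuration that differs from the identity by elements of a finite normal subgroup agrees with the identity on a finite-index subgroup.) -/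
/-- group-theoretic core of Lemma 5.1. If `N` is a finite normal
subgroup of `Γ`, `Γ₁ ≤ Γ` has finite index, and `s : Γ₁ → Γ` is a homomorphism with
`s(γ) ∈ γN` for all `γ ∈ Γ₁`, then the subgroup `{γ ∈ Γ₁ : s(γ) = γ}` has finite
index in `Γ`. -/
theorem eq_locus_finite_index {Γ : Type*} [Group Γ]
    (N : Subgroup Γ) [N.Normal] (hNfin : (N : Set Γ).Finite)
    (Γ₁ : Subgroup Γ) [Γ₁.FiniteIndex]
    (s : Γ₁ →* Γ) (hs : ∀ γ : Γ₁, (γ : Γ)⁻¹ * s γ ∈ N) :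
    (Subgroup.map Γ₁.subtype (s.eqLocus Γ₁.subtype)).FiniteIndex := by
  have : Finite N := hNfin
  have hinj : Function.Injective (fun q : Γ₁ ⧸ s.eqLocus Γ₁.subtype =>
      (⟨_, hs q.out⁻¹⟩ : N)) := by
    intro p q h
    rw [← p.out_eq', ← q.out_eq', QuotientGroup.eq]
    have h' : (p.out : Γ) * (s p.out)⁻¹ = q.out * (s q.out)⁻¹ := by
      simpa using congrArg Subtype.val h
    change s (p.out⁻¹ * q.out) = ((p.out⁻¹ * q.out : Γ₁) : Γ)
    rw [map_mul, map_inv, Subgroup.coe_mul, Subgroup.coe_inv, eq_inv_mul_iff_mul_eq, ← mul_assoc,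
      h', inv_mul_cancel_right]
  have : Finite (Γ₁ ⧸ s.eqLocus Γ₁.subtype) := Finite.of_injective _ hinj
  rw [Subgroup.finiteIndex_iff, Subgroup.index_map_subtype]
  exact mul_ne_zero Subgroup.index_ne_zero_of_finite Subgroup.FiniteIndex.index_ne_zero
end
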